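/- arXiv:1711.02291 — 2 statements merged into one kernel-verified Lean document; each statement's English description precedes it below -/
import Mathlib

section
/- Let H be a hermitian d×d complex matrix, let {L_α}_{α=1}^N be d×d complex matrices, and let L be the Lindbladian superoperator L(ρ) = −i[H,ρ] + ∑_α ( L_α ρ L_α† − ½{L_α†L_α, ρ} ). For a unit vector ψ ∈ ℂ^d, the rank-1 projector |ψ⟩⟨ψ| satisfies L(|ψ⟩⟨ψ|) = 0 if and only if both of the following hold: (a) ψ is an eigenvector of L_α for every α, and (b) ψ is an eigenvector of the matrix iH + ½ ∑_α ⟨ψ|L_α|ψ⟩ L_α†. -/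
open Matrix BigOperators

/-- The Lindbladian superoperator
`L(ρ) = −i[H,ρ] + ∑ α (L_α ρ L_α† − ½{L_α† L_α, ρ})` applied to `ρ`. -/
noncomputable def lindblad {d N : ℕ} (H : Matrix (Fin d) (Fin d) ℂ)
    (L : Fin N → Matrix (Fin d) (Fin d) ℂ) (ρ : Matrix (Fin d) (Fin d) ℂ) :
    Matrix (Fin d) (Fin d) ℂ :=
  (-Complex.I) • (H * ρ - ρ * H) +
    ∑ α, (L α * ρ * (L α)ᴴ
      - (1 / 2 : ℂ) • ((L α)ᴴ * L α * ρ + ρ * ((L α)ᴴ * L α)))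

open Matrix in
lemma lindblad_form {d N : ℕ} (H : Matrix (Fin d) (Fin d) ℂ) (hH : Hᴴ = H)
    (L : Fin N → Matrix (Fin d) (Fin d) ℂ) (ψ w : Fin d → ℂ)
    (hw : w = (-Complex.I) • (H *ᵥ ψ) - (1 / 2 : ℂ) • ∑ α, (L α)ᴴ *ᵥ (L α *ᵥ ψ)) :
    lindblad H L (vecMulVec ψ (star ψ)) = vecMulVec w (star ψ) + vecMulVec ψ (star w)
      + ∑ α, vecMulVec (L α *ᵥ ψ) (star (L α *ᵥ ψ)) := by
  have e1 : star ψ ᵥ* H = star (H *ᵥ ψ) := by rw [star_mulVec, hH]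
  have e2 : ∀ α, star ψ ᵥ* (L α)ᴴ = star (L α *ᵥ ψ) := fun α => by rw [star_mulVec]
  have e3 : ∀ α, star ψ ᵥ* ((L α)ᴴ * L α) = star ((L α)ᴴ *ᵥ (L α *ᵥ ψ)) := fun α => by
    rw [star_mulVec, star_mulVec, vecMul_vecMul, conjTranspose_conjTranspose]
  unfold lindblad
  simp only [mul_vecMulVec, vecMulVec_mul, e1, e2, e3, ← mulVec_mulVec]
  subst hw
  ext i j
  simp [Matrix.sum_apply, vecMulVec_apply, Finset.sum_add_distrib, Finset.sum_sub_distrib,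
    Finset.mul_sum, Finset.sum_mul, mul_add, sub_mul, mul_sub]
  simp only [mul_assoc, mul_left_comm]
  ring

open Matrix in
lemma lindblad_trace {d N : ℕ} (H : Matrix (Fin d) (Fin d) ℂ)
    (L : Fin N → Matrix (Fin d) (Fin d) ℂ) (ρ : Matrix (Fin d) (Fin d) ℂ) :
    (lindblad H L ρ).trace = 0 := by
  unfold lindblad
  have h : ∀ α, (L α * ρ * (L α)ᴴ).trace = ((L α)ᴴ * L α * ρ).trace := fun α => by
    rw [trace_mul_comm, mul_assoc]
  have h2 : ∀ α, (ρ * ((L α)ᴴ * L α)).trace = ((L α)ᴴ * L α * ρ).trace := fun α => by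
    rw [trace_mul_comm]
  simp only [trace_add, trace_smul, trace_sub, trace_sum, h, h2, trace_mul_comm ρ H, smul_eq_mul]
  rw [sub_self, mul_zero, zero_add]
  apply Finset.sum_eq_zero
  intro α _
  ring

/-- **Pure steady states of a Lindbladian.**
Let `H` be hermitian, `{L_α}` arbitrary matrices, and `ψ` a unit vector of `ℂ^d`.  Then
`L(|ψ⟩⟨ψ|) = 0` if and only if (a) `ψ` is an eigenvector of every `L_α`, and
(b) `ψ` is an eigenvector of `iH + ½ ∑ α ⟨ψ|L_α|ψ⟩ L_α†`. -/
theorem lindblad_rankOneProj_eq_zero_iff {d N : ℕ}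
    (H : Matrix (Fin d) (Fin d) ℂ) (hH : Hᴴ = H)
    (L : Fin N → Matrix (Fin d) (Fin d) ℂ)
    (ψ : Fin d → ℂ) (hψ : star ψ ⬝ᵥ ψ = 1) :
    lindblad H L (Matrix.vecMulVec ψ (star ψ)) = 0
      ↔ ((∀ α, ∃ c : ℂ, (L α) *ᵥ ψ = c • ψ)
          ∧ ∃ c : ℂ, (Complex.I • H
              + (1 / 2 : ℂ) • ∑ α, (star ψ ⬝ᵥ (L α *ᵥ ψ)) • (L α)ᴴ) *ᵥ ψ = c • ψ) := by
  obtain ⟨w, hw⟩ : ∃ w, w = (-Complex.I) • (H *ᵥ ψ)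
    - (1 / 2 : ℂ) • ∑ α, (L α)ᴴ *ᵥ (L α *ᵥ ψ) := ⟨_, rfl⟩
  have key := lindblad_form H hH L ψ w hw
  have tr := lindblad_trace H L (vecMulVec ψ (star ψ))
  have hA : (∀ α, L α *ᵥ ψ = (star ψ ⬝ᵥ (L α *ᵥ ψ)) • ψ) →
      (Complex.I • H + (1 / 2 : ℂ) • ∑ α, (star ψ ⬝ᵥ (L α *ᵥ ψ)) • (L α)ᴴ) *ᵥ ψ = -w := by
    intro h
    have h' : ∀ α, (L α)ᴴ *ᵥ (L α *ᵥ ψ) = (star ψ ⬝ᵥ (L α *ᵥ ψ)) • ((L α)ᴴ *ᵥ ψ) := by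
      intro α
      conv_lhs => rw [h α]
      rw [mulVec_smul]
    rw [hw]
    simp only [h', add_mulVec, smul_mulVec, sum_mulVec, neg_smul]
    abel
  constructor
  · intro h0
    rw [key] at h0
    have ha : ∀ β, L β *ᵥ ψ = (star ψ ⬝ᵥ (L β *ᵥ ψ)) • ψ := by
      intro β
      obtain ⟨v, hv⟩ : ∃ v, v = L β *ᵥ ψ - (star ψ ⬝ᵥ (L β *ᵥ ψ)) • ψ := ⟨_, rfl⟩
      have o1 : star ψ ⬝ᵥ v = 0 := by
        rw [hv, dotProduct_sub, dotProduct_smul, hψ]; simp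
      have o2 : star v ⬝ᵥ ψ = 0 := by
        have := congrArg star o1
        rwa [star_dotProduct, star_star, star_zero] at this
      have h1 := congrArg (fun M => star v ⬝ᵥ (M *ᵥ v)) h0
      simp only [add_mulVec, sum_mulVec, vecMulVec_mulVec, dotProduct_add, dotProduct_sum,
        zero_mulVec, dotProduct_zero, op_smul_eq_smul, dotProduct_smul, o1, o2, smul_eq_mul,
        zero_mul, mul_zero, zero_add] at h1
      have h2 : ∀ α, star (L α *ᵥ ψ) ⬝ᵥ v * (star v ⬝ᵥ (L α *ᵥ ψ))
          = ((Complex.normSq (star v ⬝ᵥ (L α *ᵥ ψ)) : ℝ) : ℂ) := by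
        intro α
        have h5 : star (L α *ᵥ ψ) ⬝ᵥ v = star (star v ⬝ᵥ (L α *ᵥ ψ)) := by
          rw [star_dotProduct]
        rw [Complex.normSq_eq_conj_mul_self, h5]
        rfl
      simp only [h2] at h1
      rw [← Complex.ofReal_sum, Complex.ofReal_eq_zero,
        Finset.sum_eq_zero_iff_of_nonneg (fun _ _ => Complex.normSq_nonneg _)] at h1
      have h3 := Complex.normSq_eq_zero.1 (h1 β (Finset.mem_univ _))
      have h4 : star v ⬝ᵥ v = 0 := by
        have h5 : star v ⬝ᵥ v = star v ⬝ᵥ (L β *ᵥ ψ - (star ψ ⬝ᵥ (L β *ᵥ ψ)) • ψ) :=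
          congrArg (fun x => star v ⬝ᵥ x) hv
        rw [h5, dotProduct_sub, dotProduct_smul, h3, o2]; simp
      open ComplexOrder in
      rw [dotProduct_star_self_eq_zero] at h4
      exact sub_eq_zero.1 (hv ▸ h4)
    refine ⟨fun α => ⟨_, ha α⟩, ?_⟩
    rw [hA ha]
    have h1 := congrArg (fun M => M *ᵥ ψ) h0
    simp only [add_mulVec, sum_mulVec, vecMulVec_mulVec, op_smul_eq_smul, hψ, one_smul,
      zero_mulVec] at h1
    refine ⟨star w ⬝ᵥ ψ + ∑ α, (star (L α *ᵥ ψ) ⬝ᵥ ψ) * (star ψ ⬝ᵥ (L α *ᵥ ψ)), ?_⟩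
    have h2 : ∀ α, (star (L α *ᵥ ψ) ⬝ᵥ ψ) • (L α *ᵥ ψ)
        = ((star (L α *ᵥ ψ) ⬝ᵥ ψ) * (star ψ ⬝ᵥ (L α *ᵥ ψ))) • ψ := by
      intro α
      rw [mul_smul, ← ha α]
    rw [add_smul, Finset.sum_smul, ← Finset.sum_congr rfl (fun α _ => h2 α)]
    rw [add_assoc] at h1
    exact neg_eq_of_add_eq_zero_right h1
  · rintro ⟨ha, c, hc⟩
    choose l hl using ha
    have ha : ∀ α, L α *ᵥ ψ = (star ψ ⬝ᵥ (L α *ᵥ ψ)) • ψ := by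
      intro α
      rw [hl α, dotProduct_smul, hψ]; simp
    rw [hA ha] at hc
    have hwc : w = (-c) • ψ := by rw [neg_smul, ← hc, neg_neg]
    have hk : lindblad H L (vecMulVec ψ (star ψ))
        = (-c + star (-c) + ∑ α, l α * star (l α)) • vecMulVec ψ (star ψ) := by
      rw [key, hwc]
      simp only [hl, star_smul, vecMulVec_smul, smul_vecMulVec, add_smul, Finset.sum_smul,
        smul_smul, mul_comm]
    rw [hk, trace_smul, trace_vecMulVec, dotProduct_comm, hψ, smul_eq_mul, mul_one] at tr
    rw [hk, tr, zero_smul]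
end

section
/- Let d ≥ 2 and let μ be the Haar probability measure on the unitary group U(d). Then the Haar average of the normalized 2-norm coherence generating power of random maximally dephasing channels satisfies ∫_{U(d)} (4/(d−1)) · ( Tr(X_U X_Uᵀ) − Tr((X_U X_Uᵀ)²) ) dμ(U) ≤ M(d), where (X_U)_{ij} = |⟨i|U|j⟩|² and M(d) = 4d·( d(d+5) + 2 ) / ( (d+1)²(d+2)(d+3) ). -/
open Matrix MeasureTheory BigOperators

/-- The bistochastic matrix `(X_U)_{ij} = |⟨i|U|j⟩|²` of a matrix `U`, with respect to the
standard basis. -/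
noncomputable def xMat {d : ℕ} (U : Matrix (Fin d) (Fin d) ℂ) : Matrix (Fin d) (Fin d) ℝ :=
  Matrix.of fun i j => ‖U i j‖ ^ 2

theorem unitary_compact_aux (d : ℕ) : CompactSpace (Matrix.unitaryGroup (Fin d) ℂ) := by
  refine (isCompact_iff_compactSpace (s := ((Matrix.unitaryGroup (Fin d) ℂ : Submonoid (Matrix (Fin d) (Fin d) ℂ)) :
        Set (Matrix (Fin d) (Fin d) ℂ)))).1 ?_
  have hK : IsCompact (Set.pi Set.univ fun _ : Fin d => Set.pi Set.univ fun _ : Fin d =>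
      Metric.closedBall (0 : ℂ) 1) :=
    isCompact_univ_pi fun _ => isCompact_univ_pi fun _ => isCompact_closedBall _ _
  refine IsCompact.of_isClosed_subset (X := Matrix (Fin d) (Fin d) ℂ) hK ?_ ?_
  · have : ((Matrix.unitaryGroup (Fin d) ℂ : Submonoid (Matrix (Fin d) (Fin d) ℂ)) :
        Set (Matrix (Fin d) (Fin d) ℂ)) = {U | U * star U = 1} := by
      ext U; exact Matrix.mem_unitaryGroup_iff
    rw [this]
    exact isClosed_eq (by fun_prop) (by fun_prop)
  · intro U hU i _ j _
    simpa using entry_norm_bound_of_unitary hU i j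

/-- Abstract moment relations. -/
theorem moment_aux {X : Type*} (L : (X → ℝ) → ℝ) (P : (X → ℝ) → Prop)
    (hadd : ∀ f g, P f → P g → L (fun x => f x + g x) = L f + L g)
    (hsmul : ∀ (c : ℝ) f, L (fun x => c * f x) = c * L f)
    (Padd : ∀ f g, P f → P g → P (fun x => f x + g x))
    (Pmul : ∀ f g, P f → P g → P (fun x => f x * g x))
    (Pconst : ∀ c : ℝ, P (fun _ => c))
    (A B r t : X → ℝ) (hA : P A) (hB : P B) (hr : P r) (ht : P t)
    (hrt : ∀ x, r x ^ 2 + t x ^ 2 = A x * B x)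
    (H : ∀ c s : ℝ, c ^ 2 + s ^ 2 = 1 → ∀ p q : ℕ,
      L (fun x => A x ^ p * B x ^ q) =
      L (fun x => ((A x + B x) / 2 + (c * r x + s * t x)) ^ p *
        ((A x + B x) / 2 - (c * r x + s * t x)) ^ q)) :
    L A = L B ∧
    L (fun x => A x ^ 2) = 2 * L (fun x => A x * B x) ∧
    L (fun x => A x ^ 3) = 3 * L (fun x => A x ^ 2 * B x) ∧
    L (fun x => A x ^ 4) = 4 * L (fun x => A x ^ 3 * B x) ∧
    L (fun x => A x ^ 4) = 6 * L (fun x => A x ^ 2 * B x ^ 2) := by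
  have Ppow : ∀ f, P f → ∀ n : ℕ, P (fun x => f x ^ n) := by
    intro f hf n
    induction n with
    | zero => simpa using Pconst 1
    | succ n ih => simpa [pow_succ] using Pmul _ _ ih hf
  have Psmul : ∀ (c : ℝ) f, P f → P (fun x => c * f x) := fun c f hf => Pmul _ _ (Pconst c) hf
  -- symmetry
  have sym : ∀ p q : ℕ, L (fun x => A x ^ p * B x ^ q) = L (fun x => A x ^ q * B x ^ p) := by
    intro p q
    rw [H 1 0 (by norm_num) p q, H (-1) 0 (by norm_num) q p]
    congr 1; funext x; ring
  have PQ : ∀ (c s : ℝ) (p q : ℕ), P (fun x => ((A x + B x) / 2 + (c * r x + s * t x)) ^ p *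
        ((A x + B x) / 2 - (c * r x + s * t x)) ^ q) := by
    intro c s p q
    have h1 : P (fun x => (1/2) * (A x + B x)) := Psmul _ _ (Padd _ _ hA hB)
    have h2 : ∀ c s : ℝ, P (fun x => c * r x + s * t x) := fun c s =>
      Padd _ _ (Psmul c _ hr) (Psmul s _ ht)
    have := Pmul _ _ (Ppow _ (Padd _ _ h1 (h2 c s)) p) (Ppow _ (Padd _ _ h1 (h2 (-c) (-s))) q)
    convert this using 3 <;> ring
  set h : ℝ := √(1/2) with hh
  have hsq : h ^ 2 = 1 / 2 := Real.sq_sqrt (by norm_num)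
  let F : ℝ → ℝ → ℕ → ℕ → X → ℝ := fun c s p q x =>
    ((A x + B x) / 2 + (c * r x + s * t x)) ^ p * ((A x + B x) / 2 - (c * r x + s * t x)) ^ q
  have PF : ∀ c s p q, P (F c s p q) := PQ
  have HF : ∀ c s : ℝ, c ^ 2 + s ^ 2 = 1 → ∀ p q, L (F c s p q) = L (fun x => A x ^ p * B x ^ q) :=
    fun c s hcs p q => (H c s hcs p q).symm
  have key4 : ∀ p q : ℕ, 4 * L (fun x => A x ^ p * B x ^ q) =
      L (fun x => (F 1 0 p q x + F (-1) 0 p q x) + (F 0 1 p q x + F 0 (-1) p q x)) := by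
    intro p q
    rw [hadd _ _ (Padd _ _ (PF _ _ _ _) (PF _ _ _ _)) (Padd _ _ (PF _ _ _ _) (PF _ _ _ _)),
      hadd _ _ (PF _ _ _ _) (PF _ _ _ _), hadd _ _ (PF _ _ _ _) (PF _ _ _ _),
      HF _ _ (by norm_num), HF _ _ (by norm_num), HF _ _ (by norm_num), HF _ _ (by norm_num)]
    ring
  have key4' : ∀ p q : ℕ, 4 * L (fun x => A x ^ p * B x ^ q) =
      L (fun x => (F h h p q x + F (-h) (-h) p q x) + (F h (-h) p q x + F (-h) h p q x)) := by
    intro p q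
    rw [hadd _ _ (Padd _ _ (PF _ _ _ _) (PF _ _ _ _)) (Padd _ _ (PF _ _ _ _) (PF _ _ _ _)),
      hadd _ _ (PF _ _ _ _) (PF _ _ _ _), hadd _ _ (PF _ _ _ _) (PF _ _ _ _),
      HF _ _ (by linarith), HF _ _ (by rw [neg_sq]; linarith),
      HF _ _ (by rw [neg_sq]; linarith), HF _ _ (by rw [neg_sq]; linarith)]
    ring
  have key8 : ∀ p q : ℕ, 8 * L (fun x => A x ^ p * B x ^ q) =
      L (fun x => ((F 1 0 p q x + F (-1) 0 p q x) + (F 0 1 p q x + F 0 (-1) p q x)) +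
        ((F h h p q x + F (-h) (-h) p q x) + (F h (-h) p q x + F (-h) h p q x))) := by
    intro p q
    rw [hadd _ _ (Padd _ _ (Padd _ _ (PF _ _ _ _) (PF _ _ _ _)) (Padd _ _ (PF _ _ _ _) (PF _ _ _ _)))
      (Padd _ _ (Padd _ _ (PF _ _ _ _) (PF _ _ _ _)) (Padd _ _ (PF _ _ _ _) (PF _ _ _ _))),
      ← key4, ← key4']
    ring
  have PM : ∀ p q : ℕ, P (fun x => A x ^ p * B x ^ q) := fun p q =>
    Pmul _ _ (Ppow _ hA p) (Ppow _ hB q)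
  -- expansion of linear combinations
  have lin3 : ∀ (a b c : ℝ) (f g k : X → ℝ), P f → P g → P k →
      L (fun x => (a * f x + b * g x) + c * k x) = a * L f + b * L g + c * L k := by
    intro a b c f g k hf hg hk
    rw [hadd _ _ (Padd _ _ (Psmul _ _ hf) (Psmul _ _ hg)) (Psmul _ _ hk),
      hadd _ _ (Psmul _ _ hf) (Psmul _ _ hg), hsmul, hsmul, hsmul]
  have lin5 : ∀ (a b c e i : ℝ) (f g k l m : X → ℝ), P f → P g → P k → P l → P m →
      L (fun x => ((a * f x + b * g x) + c * k x) + (e * l x + i * m x)) =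
        a * L f + b * L g + c * L k + (e * L l + i * L m) := by
    intro a b c e i f g k l m hf hg hk hl hm
    rw [hadd _ _ (Padd _ _ (Padd _ _ (Psmul _ _ hf) (Psmul _ _ hg)) (Psmul _ _ hk))
      (Padd _ _ (Psmul _ _ hl) (Psmul _ _ hm)), lin3 _ _ _ _ _ _ hf hg hk,
      hadd _ _ (Psmul _ _ hl) (Psmul _ _ hm), hsmul, hsmul]
  have e2 : 4 * L (fun x => A x ^ 2 * B x ^ 0) =
      1 * L (fun x => A x ^ 2 * B x ^ 0) + 1 * L (fun x => A x ^ 0 * B x ^ 2)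
        + 4 * L (fun x => A x ^ 1 * B x ^ 1) := by
    rw [key4, ← lin3 _ _ _ _ _ _ (PM _ _) (PM _ _) (PM _ _)]
    congr 1; funext x; simp only [F]
    linear_combination 2 * hrt x
  have e3 : 4 * L (fun x => A x ^ 3 * B x ^ 0) =
      (1/2) * L (fun x => A x ^ 3 * B x ^ 0) + (1/2) * L (fun x => A x ^ 0 * B x ^ 3)
        + 0 * L (fun x => A x ^ 1 * B x ^ 1) + ((9/2) * L (fun x => A x ^ 2 * B x ^ 1)
        + (9/2) * L (fun x => A x ^ 1 * B x ^ 2)) := by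
    rw [key4, ← lin5 _ _ _ _ _ _ _ _ _ _ (PM _ _) (PM _ _) (PM _ _) (PM _ _) (PM _ _)]
    congr 1; funext x; simp only [F]
    linear_combination 3 * (A x + B x) * hrt x
  have hsq4 : h ^ 4 = 1 / 4 := by rw [show h ^ 4 = (h ^ 2) ^ 2 by ring, hsq]; norm_num
  have e4 : 8 * L (fun x => A x ^ 4 * B x ^ 0) =
      (1/2) * L (fun x => A x ^ 4 * B x ^ 0) + (1/2) * L (fun x => A x ^ 0 * B x ^ 4)
        + 18 * L (fun x => A x ^ 2 * B x ^ 2) + (8 * L (fun x => A x ^ 3 * B x ^ 1)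
        + 8 * L (fun x => A x ^ 1 * B x ^ 3)) := by
    rw [key8, ← lin5 _ _ _ _ _ _ _ _ _ _ (PM _ _) (PM _ _) (PM _ _) (PM _ _) (PM _ _)]
    congr 1; funext x; simp only [F]
    linear_combination (6 * (A x + B x) ^ 2 + 3 * (r x ^ 2 + t x ^ 2 + A x * B x)) * hrt x
      + (12 * (A x + B x) ^ 2 * (r x ^ 2 + t x ^ 2) / 2) * hsq
      + (4 * r x ^ 4 + 24 * r x ^ 2 * t x ^ 2 + 4 * t x ^ 4) * hsq4
  have e31 : 8 * L (fun x => A x ^ 3 * B x ^ 1) =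
      (1/2) * L (fun x => A x ^ 4 * B x ^ 0) + (1/2) * L (fun x => A x ^ 0 * B x ^ 4)
        + 0 * L (fun x => A x ^ 2 * B x ^ 2) + (2 * L (fun x => A x ^ 3 * B x ^ 1)
        + 2 * L (fun x => A x ^ 1 * B x ^ 3)) := by
    rw [key8, ← lin5 _ _ _ _ _ _ _ _ _ _ (PM _ _) (PM _ _) (PM _ _) (PM _ _) (PM _ _)]
    congr 1; funext x; simp only [F]
    linear_combination (- 3 * (r x ^ 2 + t x ^ 2 + A x * B x)) * hrt x
      - (4 * r x ^ 4 + 24 * r x ^ 2 * t x ^ 2 + 4 * t x ^ 4) * hsq4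
  have s1 := sym 1 0
  have s2 := sym 2 0
  have s3 := sym 3 0
  have s21 := sym 2 1
  have s4 := sym 4 0
  have s31 := sym 3 1
  simp only [pow_one, pow_zero, mul_one, one_mul] at *
  refine ⟨s1, ?_, ?_, ?_, ?_⟩ <;> linarith

theorem pair_unitary {d : ℕ} (i k : Fin d) (hik : i ≠ k) (w : ℂ) (hw : w * star w = 1) :
    ∃ V : Matrix.unitaryGroup (Fin d) ℂ, ∀ (M : Matrix (Fin d) (Fin d) ℂ) (j : Fin d),
      ((V : Matrix (Fin d) (Fin d) ℂ) * M) i j = (√(1/2) : ℝ) * (M i j + w * M k j) ∧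
      ((V : Matrix (Fin d) (Fin d) ℂ) * M) k j = (√(1/2) : ℝ) * (M i j - w * M k j) := by
  set h : ℂ := ((√(1/2) : ℝ) : ℂ) with hh
  have hsq : h * h = 1 / 2 := by
    rw [hh, ← Complex.ofReal_mul, Real.mul_self_sqrt (by norm_num)]; norm_num
  have hst : star h = h := by simp [hh]
  let V : Matrix (Fin d) (Fin d) ℂ := Matrix.of fun a b =>
    if a = i then (if b = i then h else if b = k then h * w else 0)
    else if a = k then (if b = i then h else if b = k then - (h * w) else 0)
    else if a = b then 1 else 0
  have hVi : ∀ (M : Matrix (Fin d) (Fin d) ℂ) (j : Fin d), (V * M) i j = h * (M i j + w * M k j) := by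
    intro M j
    rw [Matrix.mul_apply, Finset.sum_eq_add i k hik]
    · simp [V, hik.symm]; ring
    · intro c _ hc; simp [V, hc.1, hc.2]
    · simp
    · simp
  have hVk : ∀ (M : Matrix (Fin d) (Fin d) ℂ) (j : Fin d), (V * M) k j = h * (M i j - w * M k j) := by
    intro M j
    rw [Matrix.mul_apply, Finset.sum_eq_add i k hik]
    · simp [V, hik.symm]; ring
    · intro c _ hc; simp [V, hc.1, hc.2]
    · simp
    · simp
  have hVo : ∀ (M : Matrix (Fin d) (Fin d) ℂ) (a j : Fin d), a ≠ i → a ≠ k → (V * M) a j = M a j := by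
    intro M a j h1 h2
    rw [Matrix.mul_apply, Finset.sum_eq_single a]
    · simp [V, h1, h2]
    · intro c _ hc; simp [V, h1, h2, hc.symm]
    · simp
  have hw' : w * (starRingEnd ℂ) w = 1 := hw
  have hst' : (starRingEnd ℂ) h = h := hst
  have hU : V ∈ Matrix.unitaryGroup (Fin d) ℂ := by
    rw [Matrix.mem_unitaryGroup_iff]
    ext a b
    by_cases hai : a = i
    · subst hai
      rw [hVi]
      by_cases hbi : b = a
      · subst hbi
        simp [V, Matrix.star_apply, hik, hik.symm, hst']
        linear_combination (h * h) * hw' + 2 * hsq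
      · by_cases hbk : b = k
        · subst hbk
          simp [V, Matrix.star_apply, hbi, Ne.symm hbi, hst']
          exact Or.inr (by linear_combination (-h) * hw')
        · simp [V, Matrix.star_apply, hbi, hbk, Ne.symm hbi]
    · by_cases hak : a = k
      · subst hak
        rw [hVk]
        by_cases hbi : b = i
        · subst hbi
          simp [V, Matrix.star_apply, hai, Ne.symm hai, hst']
          exact Or.inr (by linear_combination (-h) * hw')
        · by_cases hbk : b = a
          · subst hbk
            simp [V, Matrix.star_apply, hai, Ne.symm hai, hst']
            linear_combination (h * h) * hw' + 2 * hsq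
          · simp [V, Matrix.star_apply, hbi, hbk, Ne.symm hbk]
      · rw [hVo _ _ _ hai hak]
        by_cases hbi : b = i
        · subst hbi
          simp [V, Matrix.star_apply, hai, hak]
        · by_cases hbk : b = k
          · subst hbk
            simp [V, Matrix.star_apply, hai, hak, hbi]
          · by_cases hab : a = b
            · subst hab
              simp [V, Matrix.star_apply, hbi, hbk]
            · simp [V, Matrix.star_apply, hbi, hbk, hab, Ne.symm hab]
  exact ⟨⟨V, hU⟩, fun M j => ⟨hVi M j, hVk M j⟩⟩

theorem col_sum {d : ℕ} (U : Matrix.unitaryGroup (Fin d) ℂ) (j : Fin d) :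
    ∑ i, ‖(U : Matrix (Fin d) (Fin d) ℂ) i j‖ ^ 2 = 1 := by
  have h := Matrix.mem_unitaryGroup_iff'.1 U.2
  have h2 := congrFun (congrFun h j) j
  rw [Matrix.mul_apply, Matrix.one_apply_eq] at h2
  have : ((∑ i, ‖(U : Matrix (Fin d) (Fin d) ℂ) i j‖ ^ 2 : ℝ) : ℂ) = 1 := by
    rw [← h2]; push_cast
    refine Finset.sum_congr rfl fun i _ => ?_
    rw [Matrix.star_apply, ← Complex.conj_mul']; rfl
  exact_mod_cast this

theorem row_sum {d : ℕ} (U : Matrix.unitaryGroup (Fin d) ℂ) (i : Fin d) :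
    ∑ j, ‖(U : Matrix (Fin d) (Fin d) ℂ) i j‖ ^ 2 = 1 := by
  have h := Matrix.mem_unitaryGroup_iff.1 U.2
  have h2 := congrFun (congrFun h i) i
  rw [Matrix.mul_apply, Matrix.one_apply_eq] at h2
  have : ((∑ j, ‖(U : Matrix (Fin d) (Fin d) ℂ) i j‖ ^ 2 : ℝ) : ℂ) = 1 := by
    rw [← h2]; push_cast
    refine Finset.sum_congr rfl fun j _ => ?_
    rw [Matrix.star_apply, ← Complex.mul_conj']; rfl
  exact_mod_cast this

theorem norm_sq_aux (a b w : ℂ) (hw : w.re ^ 2 + w.im ^ 2 = 1) :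
    ‖((√(1/2) : ℝ) : ℂ) * (a + w * b)‖ ^ 2 = (‖a‖ ^ 2 + ‖b‖ ^ 2) / 2 +
      (w.re * (a.re * b.re + a.im * b.im) + w.im * (a.im * b.re - a.re * b.im)) ∧
    ‖((√(1/2) : ℝ) : ℂ) * (a - w * b)‖ ^ 2 = (‖a‖ ^ 2 + ‖b‖ ^ 2) / 2 -
      (w.re * (a.re * b.re + a.im * b.im) + w.im * (a.im * b.re - a.re * b.im)) := by
  have h1 : ‖((√(1/2) : ℝ) : ℂ)‖ ^ 2 = 1 / 2 := by
    rw [Complex.norm_real, Real.norm_eq_abs, sq_abs, Real.sq_sqrt (by norm_num)]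
  constructor <;>
  · rw [norm_mul, mul_pow, h1]
    simp only [Complex.sq_norm, Complex.normSq_apply, Complex.add_re, Complex.add_im,
      Complex.sub_re, Complex.sub_im, Complex.mul_re, Complex.mul_im]
    linear_combination ((b.re ^ 2 + b.im ^ 2) / 2) * hw

section
variable {d : ℕ} [MeasurableSpace (Matrix.unitaryGroup (Fin d) ℂ)]
    [BorelSpace (Matrix.unitaryGroup (Fin d) ℂ)]
    (μ : Measure (Matrix.unitaryGroup (Fin d) ℂ))
    [μ.IsHaarMeasure] [IsProbabilityMeasure μ]

theorem cont_int (f : Matrix.unitaryGroup (Fin d) ℂ → ℝ) (hf : Continuous f) : Integrable f μ := by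
  haveI := unitary_compact_aux d
  exact hf.integrable_of_hasCompactSupport (HasCompactSupport.of_compactSpace f)

theorem cont_entry (i j : Fin d) :
    Continuous fun U : Matrix.unitaryGroup (Fin d) ℂ => (U : Matrix (Fin d) (Fin d) ℂ) i j :=
  (continuous_apply_apply i j).comp continuous_subtype_val

theorem cont_x (i j : Fin d) :
    Continuous fun U : Matrix.unitaryGroup (Fin d) ℂ => ‖(U : Matrix (Fin d) (Fin d) ℂ) i j‖ ^ 2 :=
  (cont_entry i j).norm.pow 2

theorem pair_moments (i k j : Fin d) (hik : i ≠ k) :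
    let A := fun U : Matrix.unitaryGroup (Fin d) ℂ => ‖(U : Matrix (Fin d) (Fin d) ℂ) i j‖ ^ 2
    let B := fun U : Matrix.unitaryGroup (Fin d) ℂ => ‖(U : Matrix (Fin d) (Fin d) ℂ) k j‖ ^ 2
    ∫ U, A U ∂μ = ∫ U, B U ∂μ ∧
    ∫ U, A U ^ 2 ∂μ = 2 * ∫ U, A U * B U ∂μ ∧
    ∫ U, A U ^ 3 ∂μ = 3 * ∫ U, A U ^ 2 * B U ∂μ ∧
    ∫ U, A U ^ 4 ∂μ = 4 * ∫ U, A U ^ 3 * B U ∂μ ∧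
    ∫ U, A U ^ 4 ∂μ = 6 * ∫ U, A U ^ 2 * B U ^ 2 ∂μ := by
  intro A B
  have ci := cont_entry (d := d) i j
  have ck := cont_entry (d := d) k j
  refine moment_aux (fun f => ∫ U, f U ∂μ) Continuous
    (fun f g hf hg => integral_add (cont_int μ f hf) (cont_int μ g hg))
    (fun c f => integral_const_mul c f)
    (fun f g hf hg => hf.add hg) (fun f g hf hg => hf.mul hg) (fun c => continuous_const)
    A B
    (fun U => (U.1 i j).re * (U.1 k j).re + (U.1 i j).im * (U.1 k j).im)
    (fun U => (U.1 i j).im * (U.1 k j).re - (U.1 i j).re * (U.1 k j).im)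
    (cont_x i j) (cont_x k j)
    (((Complex.continuous_re.comp ci).mul (Complex.continuous_re.comp ck)).add
      ((Complex.continuous_im.comp ci).mul (Complex.continuous_im.comp ck)))
    (((Complex.continuous_im.comp ci).mul (Complex.continuous_re.comp ck)).sub
      ((Complex.continuous_re.comp ci).mul (Complex.continuous_im.comp ck))) ?_ ?_
  · intro U
    simp only [A, B, Complex.sq_norm, Complex.normSq_apply]
    ring
  · intro c s hcs p q
    obtain ⟨V, hV⟩ := pair_unitary i k hik (⟨c, s⟩ : ℂ) (by
      apply Complex.ext
      · simp; linarith
      · simp; ring)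
    rw [← integral_mul_left_eq_self (fun U => A U ^ p * B U ^ q) V]
    congr 1
    funext U
    have h := hV U.1 j
    have h2 := norm_sq_aux (U.1 i j) (U.1 k j) (⟨c, s⟩ : ℂ) hcs
    simp only [A, B, Submonoid.coe_mul]
    rw [h.1, h.2, h2.1, h2.2]

theorem col_moments (hd : 2 ≤ d) (j : Fin d) :
    (∀ i, ∫ U : Matrix.unitaryGroup (Fin d) ℂ, (‖(U : Matrix (Fin d) (Fin d) ℂ) i j‖ ^ 2) ^ 2 ∂μ
      = 2 / ((d : ℝ) * (d + 1))) ∧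
    ∫ U : Matrix.unitaryGroup (Fin d) ℂ,
      (∑ i, (‖(U : Matrix (Fin d) (Fin d) ℂ) i j‖ ^ 2) ^ 2) ^ 2 ∂μ
      = 4 * ((d : ℝ) + 5) / (((d : ℝ) + 1) * (d + 2) * (d + 3)) := by
  set x : Fin d → Matrix.unitaryGroup (Fin d) ℂ → ℝ :=
    fun i U => ‖(U : Matrix (Fin d) (Fin d) ℂ) i j‖ ^ 2 with hx
  have cx : ∀ i, Continuous (x i) := fun i => cont_x i j
  have hsum : ∀ U, ∑ i, x i U = 1 := fun U => col_sum U j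
  have hp : ∀ i k, i ≠ k → _ := fun i k hik => pair_moments μ i k j hik
  have hd0 : (0 : ℝ) < d := by exact_mod_cast (by omega : 0 < d)
  have m1 : ∀ i, ∫ U, x i U ∂μ = 1 / d := by
    intro i
    have h1 : ∑ k, ∫ U, x k U ∂μ = 1 := by
      rw [← integral_finsetSum _ (fun k _ => cont_int μ _ (cx k))]
      simp [hsum]
    have h2 : ∀ k, ∫ U, x k U ∂μ = ∫ U, x i U ∂μ := by
      intro k
      by_cases hk : k = i
      · rw [hk]
      · exact (hp k i hk).1
    simp only [h2, Finset.sum_const, Finset.card_univ, Fintype.card_fin, nsmul_eq_mul] at h1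
    field_simp
    linarith
  have rec' : ∀ (i : Fin d) (n : ℕ) (c : ℝ), (∀ k, k ≠ i → ∫ U, x i U ^ n * x k U ∂μ = c) →
      ∫ U, x i U ^ n ∂μ = ∫ U, x i U ^ (n + 1) ∂μ + ((d : ℝ) - 1) * c := by
    intro i n c hc
    have h1 : ∫ U, x i U ^ n ∂μ = ∑ k, ∫ U, x i U ^ n * x k U ∂μ := by
      have hcc : ∀ k, Continuous fun U => x i U ^ n * x k U := fun k => ((cx i).pow n).mul (cx k)
      rw [← integral_finsetSum _ (fun k _ => cont_int μ _ (hcc k))]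
      congr 1; funext U
      rw [← Finset.mul_sum, hsum, mul_one]
    rw [h1, ← Finset.add_sum_erase _ _ (Finset.mem_univ i),
      Finset.sum_congr rfl (fun k hk => hc k (Finset.ne_of_mem_erase hk)), Finset.sum_const,
      Finset.card_erase_of_mem (Finset.mem_univ i), Finset.card_univ, Fintype.card_fin,
      nsmul_eq_mul, Nat.cast_sub (by omega), Nat.cast_one]
    simp only [pow_succ]
  have m2 : ∀ i, ∫ U, x i U ^ 2 ∂μ = 2 / ((d : ℝ) * (d + 1)) := by
    intro i
    have := rec' i 1 ((∫ U, x i U ^ 2 ∂μ) / 2) (fun k hk => by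
      have := (hp i k hk.symm).2.1
      simp only [pow_one]
      simp only [hx] at *
      linarith)
    simp only [pow_one, m1] at this
    norm_num at this
    field_simp
    field_simp at this
    linarith
  have m3 : ∀ i, ∫ U, x i U ^ 3 ∂μ = 6 / ((d : ℝ) * (d + 1) * (d + 2)) := by
    intro i
    have := rec' i 2 ((∫ U, x i U ^ 3 ∂μ) / 3) (fun k hk => by
      have := (hp i k hk.symm).2.2.1
      simp only [hx] at *
      linarith)
    rw [m2] at this
    norm_num at this
    field_simp
    field_simp at this
    linarith
  have m4 : ∀ i, ∫ U, x i U ^ 4 ∂μ = 24 / ((d : ℝ) * (d + 1) * (d + 2) * (d + 3)) := by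
    intro i
    have := rec' i 3 ((∫ U, x i U ^ 4 ∂μ) / 4) (fun k hk => by
      have := (hp i k hk.symm).2.2.2.1
      simp only [hx] at *
      linarith)
    rw [m3] at this
    norm_num at this
    field_simp
    field_simp at this
    linarith
  have m22 : ∀ i k, i ≠ k → ∫ U, x i U ^ 2 * x k U ^ 2 ∂μ =
      4 / ((d : ℝ) * (d + 1) * (d + 2) * (d + 3)) := by
    intro i k hik
    have h := (hp i k hik).2.2.2.2
    have h4 := m4 i
    simp only [hx] at *
    rw [h4] at h
    have : (24 : ℝ) / ((d : ℝ) * (d + 1) * (d + 2) * (d + 3)) =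
      6 * (4 / ((d : ℝ) * (d + 1) * (d + 2) * (d + 3))) := by ring
    linarith
  refine ⟨m2, ?_⟩
  have h1 : ∫ U, (∑ i, x i U ^ 2) ^ 2 ∂μ = ∑ i, ∑ k, ∫ U, x i U ^ 2 * x k U ^ 2 ∂μ := by
    have hc : ∀ i k, Continuous fun U => x i U ^ 2 * x k U ^ 2 :=
      fun i k => ((cx i).pow 2).mul ((cx k).pow 2)
    simp only [sq (∑ i, _), Finset.sum_mul_sum]
    rw [integral_finsetSum _ (fun i _ => cont_int μ _ (continuous_finsetSum _ fun k _ => hc i k))]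
    refine Finset.sum_congr rfl fun i _ => ?_
    rw [integral_finsetSum _ (fun k _ => cont_int μ _ (hc i k))]
  have h2 : ∀ i, ∑ k, ∫ U, x i U ^ 2 * x k U ^ 2 ∂μ =
      24 / ((d : ℝ) * (d + 1) * (d + 2) * (d + 3)) +
        ((d : ℝ) - 1) * (4 / ((d : ℝ) * (d + 1) * (d + 2) * (d + 3))) := by
    intro i
    rw [← Finset.add_sum_erase _ _ (Finset.mem_univ i),
      Finset.sum_congr rfl (fun k hk => m22 i k (Finset.ne_of_mem_erase hk).symm), Finset.sum_const,
      Finset.card_erase_of_mem (Finset.mem_univ i), Finset.card_univ, Fintype.card_fin,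
      nsmul_eq_mul, Nat.cast_sub (by omega), Nat.cast_one, ← m4 i]
    simp only [← pow_add]
  rw [h1]
  simp only [h2, Finset.sum_const, Finset.card_univ, Fintype.card_fin, nsmul_eq_mul]
  field_simp
  ring

end

theorem trace_sq_lower {d : ℕ} (x : Matrix (Fin d) (Fin d) ℝ) (hrow : ∀ i, ∑ j, x i j = 1) (t : ℝ) :
    (x * xᵀ).trace = ∑ j, ∑ i, x i j ^ 2 ∧
    ∑ j, (∑ i, x i j ^ 2) ^ 2 + 2 * t * (d - ∑ j, ∑ i, x i j ^ 2) - d * (d - 1) * t ^ 2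
      ≤ ((x * xᵀ) ^ 2).trace := by
  constructor
  · rw [Matrix.trace_mul_comm]
    simp [Matrix.trace, Matrix.mul_apply, sq]
  · have h0 : ((x * xᵀ) ^ 2).trace = ∑ j, ∑ l, (∑ i, x i j * x i l) ^ 2 := by
      rw [sq, Matrix.mul_assoc, Matrix.trace_mul_comm, Matrix.mul_assoc, ← Matrix.mul_assoc,
        Matrix.mul_assoc, Matrix.mul_assoc]
      rw [← Matrix.mul_assoc xᵀ x (xᵀ * x)]
      simp only [Matrix.trace, Matrix.diag_apply]
      refine Finset.sum_congr rfl fun j _ => ?_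
      rw [Matrix.mul_apply]
      refine Finset.sum_congr rfl fun l _ => ?_
      simp only [Matrix.mul_apply, Matrix.transpose_apply, sq]
      congr 1
      exact Finset.sum_congr rfl fun i _ => mul_comm _ _
    have hc : ∑ j, ∑ l, ∑ i, x i j * x i l = d := by
      have : ∀ j, ∑ l, ∑ i, x i j * x i l = ∑ i, x i j := by
        intro j
        rw [Finset.sum_comm]
        refine Finset.sum_congr rfl fun i _ => ?_
        rw [← Finset.mul_sum, hrow, mul_one]
      simp only [this]
      rw [Finset.sum_comm]
      simp [hrow]
    have key : ∀ j, (∑ i, x i j ^ 2) ^ 2 - 2 * t * (∑ i, x i j ^ 2) + t ^ 2 +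
        (2 * t * (∑ l, ∑ i, x i j * x i l) - d * t ^ 2) ≤ ∑ l, (∑ i, x i j * x i l) ^ 2 := by
      intro j
      have h1 : (∑ i, x i j * x i j - t) ^ 2 ≤ ∑ l, (∑ i, x i j * x i l - t) ^ 2 :=
        Finset.single_le_sum (f := fun l => (∑ i, x i j * x i l - t) ^ 2)
          (fun l _ => sq_nonneg _) (Finset.mem_univ j)
      have h2 : ∑ l, (∑ i, x i j * x i l - t) ^ 2 = ∑ l, (∑ i, x i j * x i l) ^ 2
          - 2 * t * (∑ l, ∑ i, x i j * x i l) + d * t ^ 2 := by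
        have : ∀ y : ℝ, (y - t) ^ 2 = y ^ 2 - 2 * t * y + t ^ 2 := fun y => by ring
        simp only [this, Finset.sum_add_distrib, Finset.sum_sub_distrib, ← Finset.mul_sum]
        simp
      have h3 : ∑ i, x i j * x i j = ∑ i, x i j ^ 2 :=
        Finset.sum_congr rfl fun i _ => (sq _).symm
      rw [h3, h2] at h1
      linarith
    have := Finset.sum_le_sum fun j (_ : j ∈ Finset.univ) => key j
    rw [← h0] at this
    simp only [Finset.sum_add_distrib, Finset.sum_sub_distrib, ← Finset.mul_sum, hc,
      Finset.sum_const, Finset.card_univ, Fintype.card_fin, nsmul_eq_mul] at this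
    linarith

/-- **Upper bound for the Haar-averaged normalized CGP of random dephasing channels.**
For `d ≥ 2` and `μ` the Haar probability measure on `U(d)`,
`∫ (4/(d−1)) (Tr(X_U X_Uᵀ) − Tr((X_U X_Uᵀ)²)) dμ(U) ≤ M(d)`, where
`M(d) = 4d (d(d+5)+2) / ((d+1)²(d+2)(d+3))`. -/
theorem haar_average_cgp_le {d : ℕ} (hd : 2 ≤ d)
    [MeasurableSpace (Matrix.unitaryGroup (Fin d) ℂ)]
    [BorelSpace (Matrix.unitaryGroup (Fin d) ℂ)]
    (μ : Measure (Matrix.unitaryGroup (Fin d) ℂ))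
    [μ.IsHaarMeasure] [IsProbabilityMeasure μ] :
    ∫ U : Matrix.unitaryGroup (Fin d) ℂ,
        (4 / ((d : ℝ) - 1)) *
          ((xMat (U : Matrix (Fin d) (Fin d) ℂ) *
              (xMat (U : Matrix (Fin d) (Fin d) ℂ))ᵀ).trace
            - ((xMat (U : Matrix (Fin d) (Fin d) ℂ) *
                (xMat (U : Matrix (Fin d) (Fin d) ℂ))ᵀ) ^ 2).trace) ∂μ
      ≤ 4 * (d : ℝ) * ((d : ℝ) * ((d : ℝ) + 5) + 2)
          / (((d : ℝ) + 1) ^ 2 * ((d : ℝ) + 2) * ((d : ℝ) + 3)) := by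
  have hd2 : (2 : ℝ) ≤ d := by exact_mod_cast hd
  set D : ℝ := (d : ℝ) with hD
  set t : ℝ := 1 / (D + 1) with ht
  have cT : ∀ j, Continuous fun U : Matrix.unitaryGroup (Fin d) ℂ =>
      ∑ i, (‖(U : Matrix (Fin d) (Fin d) ℂ) i j‖ ^ 2) ^ 2 :=
    fun j => continuous_finsetSum _ fun i _ => (cont_x i j).pow 2
  have cX : Continuous fun U : Matrix.unitaryGroup (Fin d) ℂ =>
      xMat (U : Matrix (Fin d) (Fin d) ℂ) :=
    continuous_matrix fun i j => cont_x i j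
  have iT : ∫ U : Matrix.unitaryGroup (Fin d) ℂ,
      ∑ j, ∑ i, (‖(U : Matrix (Fin d) (Fin d) ℂ) i j‖ ^ 2) ^ 2 ∂μ = D * (D * (2 / (D * (D + 1)))) := by
    rw [integral_finsetSum _ (fun j _ => cont_int μ _ (cT j))]
    have : ∀ j, ∫ U : Matrix.unitaryGroup (Fin d) ℂ,
        ∑ i, (‖(U : Matrix (Fin d) (Fin d) ℂ) i j‖ ^ 2) ^ 2 ∂μ = D * (2 / (D * (D + 1))) := by
      intro j
      have hcc : ∀ i, Continuous fun U : Matrix.unitaryGroup (Fin d) ℂ =>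
          (‖(U : Matrix (Fin d) (Fin d) ℂ) i j‖ ^ 2) ^ 2 := fun i => (cont_x i j).pow 2
      rw [integral_finsetSum _ (fun i _ => cont_int μ _ (hcc i))]
      simp only [(col_moments μ hd j).1, Finset.sum_const, Finset.card_univ, Fintype.card_fin,
        nsmul_eq_mul, hD]
    simp only [this, Finset.sum_const, Finset.card_univ, Fintype.card_fin, nsmul_eq_mul, hD]
  have iQ : ∫ U : Matrix.unitaryGroup (Fin d) ℂ,
      ∑ j, (∑ i, (‖(U : Matrix (Fin d) (Fin d) ℂ) i j‖ ^ 2) ^ 2) ^ 2 ∂μ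
        = D * (4 * (D + 5) / ((D + 1) * (D + 2) * (D + 3))) := by
    have hcc : ∀ j, Continuous fun U : Matrix.unitaryGroup (Fin d) ℂ =>
        (∑ i, (‖(U : Matrix (Fin d) (Fin d) ℂ) i j‖ ^ 2) ^ 2) ^ 2 := fun j => (cT j).pow 2
    rw [integral_finsetSum _ (fun j _ => cont_int μ _ (hcc j))]
    simp only [(col_moments μ hd _).2, Finset.sum_const, Finset.card_univ, Fintype.card_fin,
      nsmul_eq_mul, hD]
  have cTT : Continuous fun U : Matrix.unitaryGroup (Fin d) ℂ =>
      ∑ j, ∑ i, (‖(U : Matrix (Fin d) (Fin d) ℂ) i j‖ ^ 2) ^ 2 :=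
    continuous_finsetSum _ fun j _ => cT j
  have cQ : Continuous fun U : Matrix.unitaryGroup (Fin d) ℂ =>
      ∑ j, (∑ i, (‖(U : Matrix (Fin d) (Fin d) ℂ) i j‖ ^ 2) ^ 2) ^ 2 :=
    continuous_finsetSum _ fun j _ => (cT j).pow 2
  rw [integral_const_mul]
  have hmain : ∫ U : Matrix.unitaryGroup (Fin d) ℂ,
      ((xMat (U : Matrix (Fin d) (Fin d) ℂ) * (xMat (U : Matrix (Fin d) (Fin d) ℂ))ᵀ).trace
        - ((xMat (U : Matrix (Fin d) (Fin d) ℂ) *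
            (xMat (U : Matrix (Fin d) (Fin d) ℂ))ᵀ) ^ 2).trace) ∂μ
      ≤ ∫ U : Matrix.unitaryGroup (Fin d) ℂ,
        (((1 + 2 * t) * ∑ j, ∑ i, (‖(U : Matrix (Fin d) (Fin d) ℂ) i j‖ ^ 2) ^ 2
          - ∑ j, (∑ i, (‖(U : Matrix (Fin d) (Fin d) ℂ) i j‖ ^ 2) ^ 2) ^ 2)
          + (D * (D - 1) * t ^ 2 - 2 * t * D)) ∂μ := by
    refine integral_mono (cont_int μ _ ?_) (cont_int μ _ ?_) ?_
    · exact (cX.matrix_mul cX.matrix_transpose).matrix_trace.sub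
        ((cX.matrix_mul cX.matrix_transpose).pow 2).matrix_trace
    · exact ((continuous_const.mul cTT).sub cQ).add continuous_const
    · intro U
      have h := trace_sq_lower (xMat (U : Matrix (Fin d) (Fin d) ℂ)) (fun i => row_sum U i) t
      have h2 := h.2
      simp only
      rw [h.1]
      simp only [xMat, Matrix.of_apply] at h2 ⊢
      linarith
  have c1 : Continuous fun U : Matrix.unitaryGroup (Fin d) ℂ =>
      (1 + 2 * t) * ∑ j, ∑ i, (‖(U : Matrix (Fin d) (Fin d) ℂ) i j‖ ^ 2) ^ 2 :=
    continuous_const.mul cTT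
  have c2 : Continuous fun U : Matrix.unitaryGroup (Fin d) ℂ =>
      (1 + 2 * t) * ∑ j, ∑ i, (‖(U : Matrix (Fin d) (Fin d) ℂ) i j‖ ^ 2) ^ 2
        - ∑ j, (∑ i, (‖(U : Matrix (Fin d) (Fin d) ℂ) i j‖ ^ 2) ^ 2) ^ 2 := c1.sub cQ
  rw [integral_add (cont_int μ _ c2) (integrable_const _),
    integral_sub (cont_int μ _ c1) (cont_int μ _ cQ),
    integral_const_mul, iT, iQ] at hmain
  simp only [integral_const, probReal_univ, smul_eq_mul, one_mul] at hmain
  have hD1 : 0 < D - 1 := by linarith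
  refine (mul_le_mul_of_nonneg_left hmain (by positivity)).trans (le_of_eq ?_)
  rw [ht]
  field_simp
  ring
end
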